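/- Let μ be a positive Borel measure on ℝ with ∫_ℝ dμ(t)/(1+t²) < ∞, and let g : (0,∞) → (0,∞) be regularly varying with index α ∈ [0,2]. Then: (i) limsup_{r→∞} (r/g(r))·P_μ(ir) ≥ (1−α/2)^{1−α/2}·(α/2)^{α/2} · limsup_{r→∞} μ↔(r)/g(r), where the constant (1−α/2)^{1−α/2}·(α/2)^{α/2} is interpreted as 1 when α = 0 or α = 2; (ii) if α < 2 and lim_{r→∞} g(r) = ∞, then limsup_{r→∞} (r/g(r))·P_μ(ir) ≤ B(1+α/2, 1−α/2) · limsup_{r→∞} μ↔(r)/g(r), where B denotes Euler's beta function. -/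

import Mathlib

open MeasureTheory Filter Topology Matrix Set
open scoped ENNReal

noncomputable section

/-- The symplectic matrix `J = [[0,-1],[1,0]]` (real version). -/
def Jmat : Matrix (Fin 2) (Fin 2) ℝ := !![0, -1; 1, 0]

/-- The symplectic matrix `J` (complex version). -/
def JmatC : Matrix (Fin 2) (Fin 2) ℂ := !![0, -1; 1, 0]

/-- `|J| = [[0,1],[1,0]]`. -/
def Jabs : Matrix (Fin 2) (Fin 2) ℝ := !![0, 1; 1, 0]

/-- The entrywise comparison `|U| ⪯ V`. -/
def entryAbsLe (U V : Matrix (Fin 2) (Fin 2) ℝ) : Prop :=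
  ∀ i j, |U i j| ≤ V i j

/-- The filter describing `t → b⁻`, `t` ranging over the reals, `b : EReal`. -/
def toBFilter (b : EReal) : Filter ℝ :=
  Filter.comap (fun t : ℝ => (t : EReal)) (nhdsWithin b (Set.Iio b))

/-- `H` is a Hamiltonian on `[a, b)`. -/
structure IsHamiltonian (a : ℝ) (b : EReal) (H : ℝ → Matrix (Fin 2) (Fin 2) ℝ) : Prop where
  a_lt_b : (a : EReal) < b
  posSemidef : ∀ᵐ (t : ℝ) ∂volume, a ≤ t → (t : EReal) < b → (H t).PosSemidef
  locInt : ∀ (i j : Fin 2) (t : ℝ), a ≤ t → (t : EReal) < b →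
    IntervalIntegrable (fun s => H s i j) volume a t
  zero_null : volume {t : ℝ | a ≤ t ∧ (t : EReal) < b ∧ H t = 0} = 0
  limit_point : (∫⁻ t in {t : ℝ | a ≤ t ∧ (t : EReal) < b},
    ENNReal.ofReal ((H t).trace)) = ⊤

/-- `m1(t) = ∫_a^t h1`. -/
def m1 (a : ℝ) (H : ℝ → Matrix (Fin 2) (Fin 2) ℝ) (t : ℝ) : ℝ := ∫ s in a..t, H s 0 0

/-- `m2(t) = ∫_a^t h2`. -/
def m2 (a : ℝ) (H : ℝ → Matrix (Fin 2) (Fin 2) ℝ) (t : ℝ) : ℝ := ∫ s in a..t, H s 1 1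

/-- `m3(t) = ∫_a^t h3`. -/
def m3 (a : ℝ) (H : ℝ → Matrix (Fin 2) (Fin 2) ℝ) (t : ℝ) : ℝ := ∫ s in a..t, H s 0 1

/-- `M(t) = ∫_a^t H(s) ds`. -/
def Mmat (a : ℝ) (H : ℝ → Matrix (Fin 2) (Fin 2) ℝ) (t : ℝ) : Matrix (Fin 2) (Fin 2) ℝ :=
  !![m1 a H t, m3 a H t; m3 a H t, m2 a H t]

/-- Neither diagonal entry of `H` vanishes a.e. on any neighbourhood of `a`. -/
def DiagNonVanishing (a : ℝ) (b : EReal) (H : ℝ → Matrix (Fin 2) (Fin 2) ℝ) : Prop :=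
  (∀ t : ℝ, a < t → (t : EReal) < b →
    ¬ ∀ᵐ s ∂(volume.restrict (Set.Ioo a t)), H s 0 0 = 0) ∧
  (∀ t : ℝ, a < t → (t : EReal) < b →
    ¬ ∀ᵐ s ∂(volume.restrict (Set.Ioo a t)), H s 1 1 = 0)

/-- `W` is the fundamental solution of `W(t,z)J − J = z ∫_a^t W(s,z)H(s) ds`. -/
def IsFundamentalSolution (a : ℝ) (b : EReal) (H : ℝ → Matrix (Fin 2) (Fin 2) ℝ)
    (W : ℝ → ℂ → Matrix (Fin 2) (Fin 2) ℂ) : Prop :=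
  ∀ (z : ℂ) (t : ℝ), a ≤ t → (t : EReal) < b →
    W t z * JmatC - JmatC =
      z • Matrix.of fun i j =>
        ∫ s in a..t, (W s z * (H s).map (fun x : ℝ => (x : ℂ))) i j

/-- `qH` is the Weyl coefficient of the Hamiltonian `H`. -/
def IsWeylCoefficient (a : ℝ) (b : EReal) (H : ℝ → Matrix (Fin 2) (Fin 2) ℝ)
    (qH : ℂ → ℂ) : Prop :=
  ∃ W : ℝ → ℂ → Matrix (Fin 2) (Fin 2) ℂ,
    IsFundamentalSolution a b H W ∧
    ∀ z : ℂ, z.im ≠ 0 → ∀ ζ : ℂ, 0 ≤ ζ.im →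
      Tendsto (fun t : ℝ =>
          (W t z 0 0 * ζ + W t z 0 1) / (W t z 1 0 * ζ + W t z 1 1))
        (toBFilter b) (nhds (qH z))

/-- `μ` is the spectral measure of `H`, i.e. the measure in the Herglotz
representation of the Weyl coefficient of `H`. -/
def IsSpectralMeasure (a : ℝ) (b : EReal) (H : ℝ → Matrix (Fin 2) (Fin 2) ℝ)
    (μ : Measure ℝ) : Prop :=
  ∃ qH : ℂ → ℂ, IsWeylCoefficient a b H qH ∧
    (∫⁻ t : ℝ, ENNReal.ofReal (1 / (1 + t ^ 2)) ∂μ) < ⊤ ∧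
    ∃ α β : ℝ, 0 ≤ β ∧ ∀ z : ℂ, z.im ≠ 0 →
      qH z = (α : ℂ) + (β : ℂ) * z +
        ∫ t : ℝ, (1 / ((t : ℂ) - z) - (t : ℂ) / (1 + (t : ℂ) ^ 2)) ∂μ

/-- `μ↔(r) = μ((−r, r))`. -/
def muSym (μ : Measure ℝ) (r : ℝ) : ℝ≥0∞ := μ (Set.Ioo (-r) r)

/-- Poisson integral of a measure. -/
def poisson (μ : Measure ℝ) (z : ℂ) : ℝ := ∫ t : ℝ, (1 / ((t : ℂ) - z)).im ∂μ

/-- `g : (0,∞) → (0,∞)` is regularly varying with index `ρ`. -/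
def RegularlyVarying (g : ℝ → ℝ) (ρ : ℝ) : Prop :=
  Measurable g ∧ (∀ r : ℝ, 0 < r → 0 < g r) ∧
  ∀ l : ℝ, 0 < l → Tendsto (fun r : ℝ => g (l * r) / g r) atTop (nhds (l ^ ρ))

/-- `g⋆(r) = ∫_1^r t/g(t) dt`. -/
def gstar (g : ℝ → ℝ) (r : ℝ) : ℝ := ∫ t in (1:ℝ)..r, t / g t

/-- The Kac class `𝓜_g`. -/
def memMg (g : ℝ → ℝ) (μ : Measure ℝ) : Prop :=
  (∫⁻ r in Set.Ici (1:ℝ), ENNReal.ofReal (1 / g r)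
    ∂(Measure.map (fun t : ℝ => |t|) μ)) < ⊤

/-- The class `𝓜̂_g`. -/
def memMhat (g : ℝ → ℝ) (μ : Measure ℝ) : Prop :=
  (∫⁻ r in Set.Ioi (1:ℝ), muSym μ r * ENNReal.ofReal (gstar g r / r ^ 3)) < ⊤

/-- The class `𝓕_g`: `μ↔(r) = O(g(r))`. -/
def memFg (g : ℝ → ℝ) (μ : Measure ℝ) : Prop :=
  ∃ C : ℝ, ∀ᶠ r in atTop, muSym μ r ≤ ENNReal.ofReal (C * g r)

/-- The class `𝓕_g⁰`: `μ↔(r) = o(g(r))`. -/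
def memFg0 (g : ℝ → ℝ) (μ : Measure ℝ) : Prop :=
  ∀ ε : ℝ, 0 < ε → ∀ᶠ r in atTop, muSym μ r ≤ ENNReal.ofReal (ε * g r)

/-- `M⁺(t)`. -/
def MplusMat (a : ℝ) (H : ℝ → Matrix (Fin 2) (Fin 2) ℝ) (t : ℝ) :
    Matrix (Fin 2) (Fin 2) ℝ :=
  !![m1 a H t, Real.sqrt (m1 a H t * m2 a H t);
     Real.sqrt (m1 a H t * m2 a H t), m2 a H t]

/-- `m⁺(t) = 2√(m1(t)m2(t))`. -/
def mplus (a : ℝ) (H : ℝ → Matrix (Fin 2) (Fin 2) ℝ) (t : ℝ) : ℝ :=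
  2 * Real.sqrt (m1 a H t * m2 a H t)

/-- `W` is the sequence of power series coefficients of the fundamental solution:
`W_0 = I`, `W_{n+1}(t) = (∫_a^t W_n H)·(−J)`. -/
def IsCoeffSeq (a : ℝ) (H : ℝ → Matrix (Fin 2) (Fin 2) ℝ)
    (W : ℕ → ℝ → Matrix (Fin 2) (Fin 2) ℝ) : Prop :=
  (∀ t : ℝ, W 0 t = 1) ∧
  ∀ (n : ℕ) (t : ℝ),
    W (n + 1) t = (Matrix.of fun i j => ∫ s in a..t, (W n s * H s) i j) * (-Jmat)

/-- Entrywise integral of a matrix-valued function. -/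
def intMat (f : ℝ → Matrix (Fin 2) (Fin 2) ℝ) (a t : ℝ) : Matrix (Fin 2) (Fin 2) ℝ :=
  Matrix.of fun i j => ∫ s in a..t, f s i j

/-- `α_{n,m}(t) = ∫_a^t W_n H W_m* ds`. -/
def alphaMat (a : ℝ) (H : ℝ → Matrix (Fin 2) (Fin 2) ℝ)
    (W : ℕ → ℝ → Matrix (Fin 2) (Fin 2) ℝ) (n m : ℕ) (t : ℝ) :
    Matrix (Fin 2) (Fin 2) ℝ :=
  intMat (fun s => W n s * H s * (W m s)ᵀ) a t

/-- `β_{n,m}(t) = W_n(t) J W_m(t)*`. -/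
def betaMat (W : ℕ → ℝ → Matrix (Fin 2) (Fin 2) ℝ) (n m : ℕ) (t : ℝ) :
    Matrix (Fin 2) (Fin 2) ℝ :=
  W n t * Jmat * (W m t)ᵀ

/-- `∇(t,z) = ∫_a^t W(s,z) H(s) W(s,z)* ds`. -/
def nablaMat (a : ℝ) (H : ℝ → Matrix (Fin 2) (Fin 2) ℝ)
    (W : ℝ → ℂ → Matrix (Fin 2) (Fin 2) ℂ) (t : ℝ) (z : ℂ) :
    Matrix (Fin 2) (Fin 2) ℂ :=
  Matrix.of fun i j =>
    ∫ s in a..t, (W s z * (H s).map (fun x : ℝ => (x : ℂ)) * (W s z)ᴴ) i j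

/-- Generalised inverse of `f : [a,b) → ℝ`. -/
def genInv (a : ℝ) (b : EReal) (f : ℝ → ℝ) (y : ℝ) : ℝ :=
  sInf {x : ℝ | a ≤ x ∧ (x : EReal) < b ∧ y ≤ f x}

/-- Generalised inverse of `f : [0,b) → [0,∞]`. -/
def genInvE (b : EReal) (f : ℝ → ℝ≥0∞) (y : ℝ) : ℝ :=
  sInf {x : ℝ | 0 ≤ x ∧ (x : EReal) < b ∧ ENNReal.ofReal y ≤ f x}

lemma muSym_mono (μ : Measure ℝ) : Monotone (muSym μ) := fun _ _ h =>
  measure_mono (Ioo_subset_Ioo (neg_le_neg h) h)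

/-- The Poisson kernel on the imaginary axis. -/
lemma im_one_div_sub_mul_I (t r : ℝ) :
    (1 / ((t : ℂ) - (r : ℂ) * Complex.I)).im = r / (t ^ 2 + r ^ 2) := by
  rw [one_div, Complex.inv_im, Complex.normSq_apply]
  simp [sq]

lemma measurable_scaledKernel (r : ℝ) : Measurable fun t : ℝ => r ^ 2 / (t ^ 2 + r ^ 2) := by
  fun_prop

lemma lintegral_scaledKernel_lt_top {μ : Measure ℝ}
    (hμ : (∫⁻ t : ℝ, ENNReal.ofReal (1 / (1 + t ^ 2)) ∂μ) < ⊤) {r : ℝ} (hr : 0 < r) :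
    (∫⁻ t : ℝ, ENNReal.ofReal (r ^ 2 / (t ^ 2 + r ^ 2)) ∂μ) < ⊤ := by
  have hle : ∀ t : ℝ, ENNReal.ofReal (r ^ 2 / (t ^ 2 + r ^ 2)) ≤
      ENNReal.ofReal (1 + r ^ 2) * ENNReal.ofReal (1 / (1 + t ^ 2)) := by
    intro t
    rw [← ENNReal.ofReal_mul (by positivity)]
    apply ENNReal.ofReal_le_ofReal
    rw [mul_one_div, div_le_div_iff₀ (by positivity) (by positivity)]
    nlinarith [sq_nonneg t, sq_nonneg (r ^ 2)]
  refine (lintegral_mono hle).trans_lt ?_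
  rw [lintegral_const_mul _ (by fun_prop)]
  exact ENNReal.mul_lt_top ENNReal.ofReal_lt_top hμ

lemma ofReal_mul_poisson {μ : Measure ℝ}
    (hμ : (∫⁻ t : ℝ, ENNReal.ofReal (1 / (1 + t ^ 2)) ∂μ) < ⊤) {r : ℝ} (hr : 0 < r) :
    ENNReal.ofReal (r * poisson μ ((r : ℂ) * Complex.I)) =
      ∫⁻ t : ℝ, ENNReal.ofReal (r ^ 2 / (t ^ 2 + r ^ 2)) ∂μ := by
  have h : r * poisson μ ((r : ℂ) * Complex.I) = ∫ t : ℝ, r ^ 2 / (t ^ 2 + r ^ 2) ∂μ := by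
    rw [poisson, ← integral_const_mul]
    congr 1 with t
    rw [im_one_div_sub_mul_I, ← mul_div_assoc, sq r]
  rw [h, integral_eq_lintegral_of_nonneg_ae (ae_of_all _ fun t => by positivity)
    (measurable_scaledKernel r).aestronglyMeasurable,
    ENNReal.ofReal_toReal (lintegral_scaledKernel_lt_top hμ hr).ne]

lemma ofReal_div_mul_poisson {μ : Measure ℝ}
    (hμ : (∫⁻ t : ℝ, ENNReal.ofReal (1 / (1 + t ^ 2)) ∂μ) < ⊤) {r c : ℝ} (hr : 0 < r)
    (hc : 0 < c) :
    ENNReal.ofReal (r / c * poisson μ ((r : ℂ) * Complex.I)) =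
      (∫⁻ t : ℝ, ENNReal.ofReal (r ^ 2 / (t ^ 2 + r ^ 2)) ∂μ) / ENNReal.ofReal c := by
  rw [← ofReal_mul_poisson hμ hr, ← ENNReal.ofReal_div_of_pos hc]
  congr 1
  ring

/-- Layer cake representation of the Poisson integral on the imaginary axis. -/
lemma lintegral_scaledKernel_eq (μ : Measure ℝ) {r : ℝ} (hr : 0 < r) :
    (∫⁻ t : ℝ, ENNReal.ofReal (r ^ 2 / (t ^ 2 + r ^ 2)) ∂μ) =
      ∫⁻ x in Ioo (0 : ℝ) 1, muSym μ (r * √((1 - x) / x)) := by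
  rw [lintegral_eq_lintegral_meas_lt μ (ae_of_all _ fun t => by positivity)
    (measurable_scaledKernel r).aemeasurable,
    ← Ioo_union_Ici_eq_Ioi (zero_lt_one' ℝ),
    lintegral_union measurableSet_Ici (by
      rw [Set.disjoint_left]; intro x hx hx'; exact absurd hx.2 (not_lt.2 hx'))]
  have hzero : ∫⁻ x in Ici (1 : ℝ), μ {t : ℝ | x < r ^ 2 / (t ^ 2 + r ^ 2)} = 0 := by
    rw [setLIntegral_congr_fun (g := fun _ => 0) measurableSet_Ici, lintegral_zero]
    intro x hx
    have : {t : ℝ | x < r ^ 2 / (t ^ 2 + r ^ 2)} = ∅ := by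
      ext t
      simp only [mem_ofPred_eq, mem_empty_iff_false, iff_false, not_lt]
      refine le_trans ?_ (mem_Ici.1 hx)
      rw [div_le_one (by positivity)]
      nlinarith [sq_nonneg t]
    simp only [this, measure_empty]
  rw [hzero, add_zero]
  refine setLIntegral_congr_fun measurableSet_Ioo fun x hx => ?_
  have hx0 := hx.1
  have hx1 : 0 < 1 - x := sub_pos.2 hx.2
  have hset : {t : ℝ | x < r ^ 2 / (t ^ 2 + r ^ 2)} =
      Ioo (-(r * √((1 - x) / x))) (r * √((1 - x) / x)) := by
    ext t
    rw [mem_Ioo, ← abs_lt, ← abs_of_nonneg (show 0 ≤ r * √((1 - x) / x) by positivity),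
      ← sq_lt_sq, mul_pow, Real.sq_sqrt (by positivity), mem_ofPred_eq,
      lt_div_iff₀ (by positivity), ← mul_div_assoc, lt_div_iff₀ hx0]
    constructor <;> intro h <;> nlinarith
  simp only [hset, muSym]

lemma setLIntegral_rpow_mul_rpow {a b : ℝ} (ha : 0 < a) (hb : 0 < b) :
    ∫⁻ x in Ioo (0 : ℝ) 1, ENNReal.ofReal (x ^ (a - 1) * (1 - x) ^ (b - 1)) =
      ENNReal.ofReal (ProbabilityTheory.beta a b) := by
  have hB := ProbabilityTheory.beta_pos ha hb
  have h := ProbabilityTheory.lintegral_betaPDF_eq_one ha hb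
  rw [ProbabilityTheory.lintegral_betaPDF] at h
  have h' : ∀ x : ℝ, ENNReal.ofReal
      (1 / ProbabilityTheory.beta a b * x ^ (a - 1) * (1 - x) ^ (b - 1)) =
      ENNReal.ofReal (1 / ProbabilityTheory.beta a b) *
        ENNReal.ofReal (x ^ (a - 1) * (1 - x) ^ (b - 1)) := fun x => by
    rw [← ENNReal.ofReal_mul (by positivity), mul_assoc]
  simp_rw [h'] at h
  rw [lintegral_const_mul _ (by fun_prop)] at h
  calc _ = ENNReal.ofReal (ProbabilityTheory.beta a b) *
        (ENNReal.ofReal (1 / ProbabilityTheory.beta a b) *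
        ∫⁻ x in Ioo (0 : ℝ) 1, ENNReal.ofReal (x ^ (a - 1) * (1 - x) ^ (b - 1))) := by
        rw [← mul_assoc, ← ENNReal.ofReal_mul hB.le, mul_one_div_cancel hB.ne',
          ENNReal.ofReal_one, one_mul]
    _ = _ := by rw [h, mul_one]

lemma setLIntegral_sqrt_rpow {β : ℝ} (h0 : 0 ≤ β) (h2 : β < 2) :
    ∫⁻ x in Ioo (0 : ℝ) 1, ENNReal.ofReal (√((1 - x) / x) ^ β) =
      ENNReal.ofReal (ProbabilityTheory.beta (1 + β / 2) (1 - β / 2)) := by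
  have hcomm : ProbabilityTheory.beta (1 + β / 2) (1 - β / 2) =
      ProbabilityTheory.beta (1 - β / 2) (1 + β / 2) := by
    simp only [ProbabilityTheory.beta, mul_comm, add_comm]
  rw [hcomm, ← setLIntegral_rpow_mul_rpow (by linarith) (by linarith)]
  refine setLIntegral_congr_fun measurableSet_Ioo fun x hx => ?_
  have hx1 : 0 ≤ 1 - x := sub_nonneg.2 hx.2.le
  have hx0 := hx.1.le
  have he : √((1 - x) / x) ^ β = x ^ (1 - β / 2 - 1) * (1 - x) ^ (1 + β / 2 - 1) := by
    rw [Real.sqrt_eq_rpow, ← Real.rpow_mul (by positivity), Real.div_rpow hx1 hx0,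
      show 1 - β / 2 - 1 = -(1 / 2 * β) by ring, show 1 + β / 2 - 1 = 1 / 2 * β by ring,
      Real.rpow_neg hx0]
    ring
  simp only [he]

namespace RegularlyVarying

variable {g : ℝ → ℝ} {α : ℝ}

lemma exists_dyadic_bound (hg : RegularlyVarying g α) {β : ℝ} (hβ : α < β) :
    ∃ R : ℝ, 0 < R ∧ ∀ r : ℝ, R ≤ r → ∀ n : ℕ, g (2 ^ n * r) ≤ ((2 : ℝ) ^ β) ^ n * g r := by
  have hlt : (2 : ℝ) ^ α < 2 ^ β := Real.rpow_lt_rpow_of_exponent_lt one_lt_two hβ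
  obtain ⟨R, hR⟩ := eventually_atTop.1 ((hg.2.2 2 two_pos).eventually (gt_mem_nhds hlt))
  refine ⟨max R 1, by positivity, fun r hr n => ?_⟩
  have hr1 : 1 ≤ r := (le_max_right _ _).trans hr
  have hRr : R ≤ r := (le_max_left _ _).trans hr
  induction n with
  | zero => simp
  | succ n ih =>
    have hge : r ≤ 2 ^ n * r := le_mul_of_one_le_left (by linarith) (one_le_pow₀ one_le_two)
    have h := hR _ (hRr.trans hge)
    rw [div_lt_iff₀ (hg.2.1 _ (by linarith))] at h
    calc g (2 ^ (n + 1) * r) = g (2 * (2 ^ n * r)) := by congr 1; ring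
      _ ≤ 2 ^ β * g (2 ^ n * r) := h.le
      _ ≤ 2 ^ β * (((2 : ℝ) ^ β) ^ n * g r) := by gcongr
      _ = _ := by ring

/-- A Potter type bound for the symmetric distribution function of a measure. -/
lemma exists_muSym_bound (hg : RegularlyVarying g α) (hα0 : 0 ≤ α) (μ : Measure ℝ)
    (hL : limsup (fun r : ℝ => muSym μ r / ENNReal.ofReal (g r)) atTop ≠ ⊤)
    {β : ℝ} (hβ : α < β) :
    ∃ (M : ℝ≥0∞) (R : ℝ), M ≠ ⊤ ∧ 0 < R ∧ ∀ r : ℝ, R ≤ r → ∀ u : ℝ, 0 ≤ u →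
      muSym μ (r * u) / ENNReal.ofReal (g r) ≤ M * (1 + ENNReal.ofReal (2 ^ β * u ^ β)) := by
  obtain ⟨M, hLM, hM⟩ := exists_between hL.lt_top
  obtain ⟨R₁, hR₁⟩ := eventually_atTop.1 (eventually_lt_of_limsup_lt hLM)
  obtain ⟨R₂, hR₂, hdy⟩ := hg.exists_dyadic_bound hβ
  have hbd : ∀ s, max R₁ R₂ ≤ s → muSym μ s ≤ M * ENNReal.ofReal (g s) := fun s hs => by
    have hs0 := hR₂.trans_le ((le_max_right _ _).trans hs)
    exact (ENNReal.div_le_iff_le_mul (.inl (ENNReal.ofReal_pos.2 (hg.2.1 s hs0)).ne')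
      (.inl ENNReal.ofReal_ne_top)).1 (hR₁ s ((le_max_left _ _).trans hs)).le
  refine ⟨M, max R₁ R₂, hM.ne, lt_max_of_lt_right hR₂, fun r hr u hu => ?_⟩
  have hr2 : R₂ ≤ r := (le_max_right _ _).trans hr
  have hr0 := hR₂.trans_le hr2
  apply ENNReal.div_le_of_le_mul
  rcases le_or_gt u 1 with hu1 | hu1
  · calc muSym μ (r * u) ≤ muSym μ r := muSym_mono μ (mul_le_of_le_one_right hr0.le hu1)
      _ ≤ M * ENNReal.ofReal (g r) := hbd r hr
      _ ≤ _ := by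
        gcongr
        exact le_mul_of_one_le_right zero_le le_self_add
  · obtain ⟨n, hn, hn'⟩ := exists_nat_pow_near hu1.le (one_lt_two (α := ℝ))
    have hge : r ≤ 2 ^ (n + 1) * r :=
      le_mul_of_one_le_left hr0.le (one_le_pow₀ one_le_two)
    have hpow : ((2 : ℝ) ^ β) ^ (n + 1) ≤ 2 ^ β * u ^ β := by
      rw [pow_succ', ← Real.rpow_natCast, ← Real.rpow_mul two_pos.le, mul_comm β,
        Real.rpow_mul two_pos.le, Real.rpow_natCast]
      gcongr
      linarith
    calc muSym μ (r * u) ≤ muSym μ (2 ^ (n + 1) * r) :=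
          muSym_mono μ (by rw [mul_comm]; gcongr)
      _ ≤ M * ENNReal.ofReal (g (2 ^ (n + 1) * r)) := hbd _ (hr.trans hge)
      _ ≤ M * ENNReal.ofReal (2 ^ β * u ^ β * g r) := by
        gcongr
        exact (hdy r hr2 (n + 1)).trans
          (mul_le_mul_of_nonneg_right hpow (hg.2.1 r hr0).le)
      _ = M * ENNReal.ofReal (2 ^ β * u ^ β) * ENNReal.ofReal (g r) := by
        rw [ENNReal.ofReal_mul (by positivity), mul_assoc]
      _ ≤ _ := by
        gcongr
        exact le_add_self

lemma tendsto_ofReal_div (hg : RegularlyVarying g α) {l : ℝ} (hl : 0 < l) :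
    Tendsto (fun r => ENNReal.ofReal (g (l * r) / g r)) atTop
      (𝓝 (ENNReal.ofReal (l ^ α))) :=
  (ENNReal.continuous_ofReal.tendsto _).comp (hg.2.2 l hl)

lemma muSym_mul_div_eq (hg : RegularlyVarying g α) (μ : Measure ℝ) {l r : ℝ} (hl : 0 < l)
    (hr : 0 < r) :
    muSym μ (l * r) / ENNReal.ofReal (g r) =
      muSym μ (l * r) / ENNReal.ofReal (g (l * r)) * ENNReal.ofReal (g (l * r) / g r) := by
  have h := hg.2.1 _ (mul_pos hl hr)
  rw [ENNReal.ofReal_div_of_pos (hg.2.1 r hr), div_eq_mul_inv (ENNReal.ofReal _), ← mul_assoc,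
    ENNReal.div_mul_cancel (ENNReal.ofReal_pos.2 h).ne' ENNReal.ofReal_ne_top, div_eq_mul_inv]

lemma limsup_muSym_mul_div (hg : RegularlyVarying g α) (μ : Measure ℝ) {l : ℝ} (hl : 0 < l) :
    limsup (fun r : ℝ => muSym μ (l * r) / ENNReal.ofReal (g r)) atTop =
      ENNReal.ofReal (l ^ α) *
        limsup (fun r : ℝ => muSym μ r / ENNReal.ofReal (g r)) atTop := by
  have hmap : map (fun r : ℝ => l * r) atTop = atTop := (OrderIso.mulLeft₀ l hl).map_atTop
  have hlim : limsup (fun r : ℝ => muSym μ (l * r) / ENNReal.ofReal (g (l * r))) atTop =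
      limsup (fun r : ℝ => muSym μ r / ENNReal.ofReal (g r)) atTop := by
    conv_rhs => rw [← hmap]
    rfl
  have ht := hg.tendsto_ofReal_div hl
  have hpos : ENNReal.ofReal (l ^ α) ≠ 0 :=
    (ENNReal.ofReal_pos.2 (Real.rpow_pos_of_pos hl α)).ne'
  have hcongr : (fun r : ℝ => muSym μ (l * r) / ENNReal.ofReal (g r)) =ᶠ[atTop]
      (fun r : ℝ => muSym μ (l * r) / ENNReal.ofReal (g (l * r))) *
        fun r : ℝ => ENNReal.ofReal (g (l * r) / g r) := by
    filter_upwards [eventually_gt_atTop 0] with r hr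
    exact hg.muSym_mul_div_eq μ hl hr
  rw [limsup_congr hcongr, mul_comm (ENNReal.ofReal _), ← hlim]
  apply le_antisymm
  · refine (ENNReal.limsup_mul_le' ?_ ?_).trans_eq (by rw [ht.limsup_eq])
    · rw [ht.limsup_eq]; exact .inr ENNReal.ofReal_ne_top
    · rw [ht.limsup_eq]; exact .inr hpos
  · conv_lhs => rw [← ht.liminf_eq]
    exact ENNReal.le_limsup_mul

lemma mul_limsup_le_limsup_poisson (hg : RegularlyVarying g α) {μ : Measure ℝ}
    (hμ : (∫⁻ t : ℝ, ENNReal.ofReal (1 / (1 + t ^ 2)) ∂μ) < ⊤) {l : ℝ} (hl : 0 < l) :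
    ENNReal.ofReal (l ^ α / (1 + l ^ 2)) *
        limsup (fun r : ℝ => muSym μ r / ENNReal.ofReal (g r)) atTop ≤
      limsup (fun r : ℝ => ENNReal.ofReal (r / g r * poisson μ ((r : ℂ) * Complex.I)))
        atTop := by
  rw [div_eq_inv_mul, ENNReal.ofReal_mul (by positivity), mul_assoc,
    ← hg.limsup_muSym_mul_div μ hl,
    ← ENNReal.limsup_const_mul_of_ne_top ENNReal.ofReal_ne_top]
  refine limsup_le_limsup ?_
  filter_upwards [eventually_gt_atTop 0] with r hr
  rw [ofReal_div_mul_poisson hμ hr (hg.2.1 r hr), ← mul_div_assoc]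
  refine ENNReal.div_le_div_right ?_ _
  calc ENNReal.ofReal (1 + l ^ 2)⁻¹ * muSym μ (l * r)
      = ∫⁻ t in Ioo (-(l * r)) (l * r), ENNReal.ofReal (1 + l ^ 2)⁻¹ ∂μ := by
        rw [setLIntegral_const, muSym]
    _ ≤ ∫⁻ t in Ioo (-(l * r)) (l * r), ENNReal.ofReal (r ^ 2 / (t ^ 2 + r ^ 2)) ∂μ := by
        refine setLIntegral_mono' measurableSet_Ioo fun t ht => ENNReal.ofReal_le_ofReal ?_
        have h := sq_lt_sq' ht.1 ht.2
        rw [inv_eq_one_div, div_le_div_iff₀ (by positivity) (by positivity)]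
        nlinarith
    _ ≤ _ := setLIntegral_le_lintegral _ _

lemma limsup_poisson_le (hg : RegularlyVarying g α) (hα0 : 0 ≤ α) (hα2 : α < 2)
    {μ : Measure ℝ} (hμ : (∫⁻ t : ℝ, ENNReal.ofReal (1 / (1 + t ^ 2)) ∂μ) < ⊤) :
    limsup (fun r : ℝ => ENNReal.ofReal (r / g r * poisson μ ((r : ℂ) * Complex.I))) atTop ≤
      ENNReal.ofReal (ProbabilityTheory.beta (1 + α / 2) (1 - α / 2)) *
        limsup (fun r : ℝ => muSym μ r / ENNReal.ofReal (g r)) atTop := by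
  have hBpos : ENNReal.ofReal (ProbabilityTheory.beta (1 + α / 2) (1 - α / 2)) ≠ 0 :=
    (ENNReal.ofReal_pos.2
      (ProbabilityTheory.beta_pos (by linarith) (by linarith))).ne'
  by_cases hL : limsup (fun r : ℝ => muSym μ r / ENNReal.ofReal (g r)) atTop = ⊤
  · rw [hL, ENNReal.mul_top hBpos]
    exact le_top
  obtain ⟨β, hαβ, hβ2⟩ := exists_between hα2
  obtain ⟨M, R, hM, hR, hbd⟩ := hg.exists_muSym_bound hα0 μ hL hαβ
  refine le_of_forall_lt fun c hc => ?_
  obtain ⟨c', hcc', hc'⟩ := exists_between hc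
  refine hcc'.trans_le ?_
  have hfreq := (frequently_lt_of_lt_limsup (by isBoundedDefault) hc').and_eventually
    (eventually_ge_atTop R)
  obtain ⟨s, hs, hs'⟩ := exists_seq_forall_of_frequently hfreq
  have hs0 : ∀ n, 0 < s n := fun n => hR.trans_le (hs' n).2
  set F : ℕ → ℝ → ℝ≥0∞ := fun n x =>
    muSym μ (s n * √((1 - x) / x)) / ENNReal.ofReal (g (s n)) with hF
  have hm : ∀ n, Measurable fun x : ℝ => muSym μ (s n * √((1 - x) / x)) := fun n =>
    (muSym_mono μ).measurable.comp (by fun_prop)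
  have hFm : ∀ n, Measurable (F n) := fun n => (hm n).div_const _
  have hFint : ∀ n, c' ≤ ∫⁻ x in Ioo (0 : ℝ) 1, F n x := fun n => by
    refine (hs' n).1.le.trans_eq ?_
    rw [ofReal_div_mul_poisson hμ (hs0 n) (hg.2.1 _ (hs0 n)),
      lintegral_scaledKernel_eq μ (hs0 n), div_eq_mul_inv,
      ← lintegral_mul_const _ (hm n)]
    rfl
  have hfin : ∫⁻ x in Ioo (0 : ℝ) 1,
      M * (1 + ENNReal.ofReal (2 ^ β * √((1 - x) / x) ^ β)) ≠ ⊤ := by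
    have hm : Measurable fun x : ℝ => √((1 - x) / x) ^ β := by fun_prop
    rw [lintegral_const_mul _ (by fun_prop), lintegral_add_left (by fun_prop)]
    simp_rw [ENNReal.ofReal_mul (show (0 : ℝ) ≤ 2 ^ β by positivity)]
    rw [lintegral_const_mul _ (by fun_prop), setLIntegral_sqrt_rpow (by linarith) hβ2]
    refine ENNReal.mul_ne_top hM (ENNReal.add_ne_top.2 ⟨by simp, ?_⟩)
    exact ENNReal.mul_ne_top ENNReal.ofReal_ne_top ENNReal.ofReal_ne_top
  calc c' ≤ limsup (fun n => ∫⁻ x in Ioo (0 : ℝ) 1, F n x) atTop :=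
        le_limsup_of_frequently_le (Frequently.of_forall hFint)
    _ ≤ ∫⁻ x in Ioo (0 : ℝ) 1, limsup (fun n => F n x) atTop :=
        limsup_lintegral_le _ hFm (fun n => ae_of_all _ fun x =>
          hbd (s n) (hs' n).2 _ (Real.sqrt_nonneg _)) hfin
    _ ≤ ∫⁻ x in Ioo (0 : ℝ) 1, ENNReal.ofReal (√((1 - x) / x) ^ α) *
          limsup (fun r : ℝ => muSym μ r / ENNReal.ofReal (g r)) atTop := by
        refine setLIntegral_mono' measurableSet_Ioo fun x hx => ?_
        have hu : 0 < √((1 - x) / x) :=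
          Real.sqrt_pos.2 (div_pos (sub_pos.2 hx.2) hx.1)
        rw [← hg.limsup_muSym_mul_div μ hu]
        simp only [hF, mul_comm (s _)]
        exact limsup_le_limsup_of_le (f := map s atTop)
          (u := fun r => muSym μ (√((1 - x) / x) * r) / ENNReal.ofReal (g r)) hs
    _ = _ := by
        have hm : Measurable fun x : ℝ => √((1 - x) / x) ^ α := by fun_prop
        rw [lintegral_mul_const _ (by fun_prop), setLIntegral_sqrt_rpow hα0 hα2]

end RegularlyVarying

/-- Lemma 4.13: limsup estimates for the Poisson integral. -/
theorem stmt12 (μ : Measure ℝ)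
    (hμ : (∫⁻ t : ℝ, ENNReal.ofReal (1 / (1 + t ^ 2)) ∂μ) < ⊤)
    (g : ℝ → ℝ) (α : ℝ) (hα0 : 0 ≤ α) (hα2 : α ≤ 2)
    (hg : RegularlyVarying g α) :
    (ENNReal.ofReal ((1 - α / 2) ^ (1 - α / 2) * (α / 2) ^ (α / 2)) *
        Filter.limsup (fun r : ℝ => muSym μ r / ENNReal.ofReal (g r)) atTop ≤
      Filter.limsup
        (fun r : ℝ => ENNReal.ofReal (r / g r * poisson μ ((r : ℂ) * Complex.I)))
        atTop) ∧
    (α < 2 → Tendsto g atTop atTop →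
      Filter.limsup
          (fun r : ℝ => ENNReal.ofReal (r / g r * poisson μ ((r : ℂ) * Complex.I)))
          atTop ≤
        ENNReal.ofReal (Real.Gamma (1 + α / 2) * Real.Gamma (1 - α / 2) /
            Real.Gamma ((1 + α / 2) + (1 - α / 2))) *
          Filter.limsup (fun r : ℝ => muSym μ r / ENNReal.ofReal (g r)) atTop) := by
  refine ⟨?_, fun h2 _ => hg.limsup_poisson_le hα0 h2 hμ⟩
  have key := fun l : ℝ => hg.mul_limsup_le_limsup_poisson hμ (l := l)
  have hlim : Tendsto (fun l : ℝ => ENNReal.ofReal (1 / (1 + l ^ 2))) (𝓝[>] 0) (𝓝 1) := by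
    have : Continuous fun l : ℝ => ENNReal.ofReal (1 / (1 + l ^ 2)) :=
      ENNReal.continuous_ofReal.comp
        (continuous_const.div (by fun_prop) fun l => by positivity)
    simpa using (this.tendsto 0).mono_left nhdsWithin_le_nhds
  have hlimit : Tendsto (fun l : ℝ => ENNReal.ofReal (1 / (1 + l ^ 2)) *
      limsup (fun r : ℝ => muSym μ r / ENNReal.ofReal (g r)) atTop) (𝓝[>] 0)
      (𝓝 (1 * limsup (fun r : ℝ => muSym μ r / ENNReal.ofReal (g r)) atTop)) :=
    ENNReal.Tendsto.mul_const hlim (.inl one_ne_zero)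
  rcases hα0.eq_or_lt with rfl | hα0
  · simp only [zero_div, sub_zero, Real.one_rpow, Real.rpow_zero, mul_one, ENNReal.ofReal_one]
    refine le_of_tendsto hlimit ?_
    filter_upwards [self_mem_nhdsWithin] with l hl
    simpa only [Real.rpow_zero] using key l hl
  rcases hα2.eq_or_lt with rfl | hα2
  · rw [div_self two_ne_zero, sub_self, Real.one_rpow, Real.rpow_zero, mul_one,
      ENNReal.ofReal_one]
    refine le_of_tendsto hlimit ?_
    filter_upwards [self_mem_nhdsWithin] with l hl
    have hl : 0 < l := hl
    have h := key l⁻¹ (inv_pos.2 hl)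
    rwa [Real.rpow_two, show l⁻¹ ^ 2 / (1 + l⁻¹ ^ 2) = 1 / (1 + l ^ 2) by
      field_simp; ring] at h
  · have hp : 0 < α / 2 := by linarith
    have hq : 0 < 1 - α / 2 := by linarith
    convert key √((α / 2) / (1 - α / 2)) (by positivity) using 3
    rw [Real.sq_sqrt (by positivity), Real.sqrt_eq_rpow, ← Real.rpow_mul (by positivity),
      Real.div_rpow hp.le hq.le, show 1 / 2 * α = α / 2 by ring, Real.rpow_sub hq,
      Real.rpow_one]
    have := (Real.rpow_pos_of_pos hq (α / 2)).ne'
    field_simp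
    ring

end
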